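/- arXiv:1807.08648 — 2 statements merged into one kernel-verified Lean document; each statement's English description precedes it below -/
import Mathlib

section
/- For p, h ≥ 0 let P_{p,h} denote the number of Dyck prefixes of length p ending at height h (words over {U, D} of length p with every prefix having at least as many U's as D's and final excess of U's over D's equal to h). Let S_{n,q} denote the number of Schröder words of semilength n with exactly q H steps, and let multichoose(m, i) = binom(m+i−1, i). Then for all n ≥ 0 and k ≥ 2, the number of Schröder words of semilength n avoiding the pattern H^{k−1} U D (k−1 consecutive H steps followed by U and then D) equals Σ_{q=0}^{k−2} S_{n,q} + Σ_{p=0}^{2n−2k+2} Σ_{h=0}^{2n−p−2k+2} P_{p,h} · multichoose(p+1, k−2) · multichoose((2n−h−p−2k+4)/2, h), where the terms are nonzero only when p ≡ h (mod 2), so (2n−h−p−2k+4)/2 is an integer in every nonzero term. -/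
/-- Steps of a Schröder path: `U` = (1,1), `D` = (1,-1), `H` = (2,0). -/
inductive Step : Type
  | U : Step
  | D : Step
  | H : Step
  deriving DecidableEq

/-- Number of `U` steps of a word. -/
def countU (w : List Step) : ℕ := w.count Step.U

/-- Number of `D` steps of a word. -/
def countD (w : List Step) : ℕ := w.count Step.D

/-- Number of `H` steps of a word. -/
def countH (w : List Step) : ℕ := w.count Step.H

/-- A word is a Schröder word if every prefix has at least as many `U`'s as `D`'s
and the whole word has equally many `U`'s and `D`'s. -/
def IsSchroder (w : List Step) : Prop :=
  (∀ p : List Step, p <+: w → countD p ≤ countU p) ∧ countU w = countD w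

/-- The semilength of a Schröder word. -/
def semilength (w : List Step) : ℕ := countU w + countH w

/-- `schroderAvoidCount n P` is the number of Schröder words of semilength `n`
avoiding the pattern `P` (i.e. not containing `P` as a not-necessarily-contiguous
subword). -/
noncomputable def schroderAvoidCount (n : ℕ) (P : List Step) : ℕ :=
  Nat.card {w : List Step // IsSchroder w ∧ semilength w = n ∧ ¬ P.Sublist w}

/-- The multiset coefficient: `multichoose m i = binom(m + i - 1, i)` counts
multisets of cardinality `i` from a set of cardinality `m`. -/
def multichoose (m i : ℕ) : ℕ := Nat.choose (m + i - 1) i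

/-- `schroderHCount n q` is the number of Schröder words of semilength `n`
with exactly `q` horizontal steps. -/
noncomputable def schroderHCount (n q : ℕ) : ℕ :=
  Nat.card {w : List Step // IsSchroder w ∧ semilength w = n ∧ countH w = q}

/-- A Dyck prefix: a word over `{U, D}` (no `H` steps) in which every prefix has
at least as many `U`'s as `D`'s. -/
def IsDyckPrefix (w : List Step) : Prop :=
  countH w = 0 ∧ ∀ p : List Step, p <+: w → countD p ≤ countU p

/-- `dyckPrefixCount p h` is the number of Dyck prefixes of length `p`
ending at height `h`. -/
noncomputable def dyckPrefixCount (p h : ℕ) : ℕ :=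
  Nat.card {w : List Step // IsDyckPrefix w ∧ w.length = p ∧ countU w = countD w + h}

open Step

/-- Every prefix has at least as many `U`'s as `D`'s. -/
def Pre (w : List Step) : Prop := ∀ p : List Step, p <+: w → countD p ≤ countU p

instance : Finite Step := by
  have : Function.Injective (fun s : Step => (match s with | U => 0 | D => 1 | H => 2 : Fin 3)) := by
    intro a b; cases a <;> cases b <;> simp
  exact Finite.of_injective _ this

theorem length_counts (w : List Step) : w.length = countU w + countD w + countH w := by
  induction w with
  | nil => simp [countU, countD, countH]
  | cons x w ih =>
    cases x <;> simp [countU, countD, countH, List.count_cons] at * <;> omega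

theorem cU_app (a b : List Step) : countU (a ++ b) = countU a + countU b := by simp [countU]
theorem cD_app (a b : List Step) : countD (a ++ b) = countD a + countD b := by simp [countD]
theorem cH_app (a b : List Step) : countH (a ++ b) = countH a + countH b := by simp [countH]
theorem cU_cons (x : Step) (b : List Step) :
    countU (x :: b) = countU b + if x = U then 1 else 0 := by simp [countU, List.count_cons]
theorem cD_cons (x : Step) (b : List Step) :
    countD (x :: b) = countD b + if x = D then 1 else 0 := by simp [countD, List.count_cons]
theorem cH_cons (x : Step) (b : List Step) :
    countH (x :: b) = countH b + if x = H then 1 else 0 := by simp [countH, List.count_cons]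
theorem cU_nil : countU [] = 0 := rfl
theorem cD_nil : countD [] = 0 := rfl
theorem cH_nil : countH [] = 0 := rfl

theorem finite_of_le (S : Set (List Step)) (N : ℕ) (h : ∀ w ∈ S, w.length ≤ N) : S.Finite :=
  (List.finite_length_le Step N).subset h

/-- Splitting a set of words by first letter. -/
theorem ncard_first (S : Set (List Step)) (hS : S.Finite) :
    S.ncard = (S ∩ {[]}).ncard + {w | U :: w ∈ S}.ncard + {w | D :: w ∈ S}.ncard
      + {w | H :: w ∈ S}.ncard := by
  have inj : ∀ x : Step, Function.Injective (List.cons x) := fun x => List.cons_injective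
  have e : S = (((S ∩ {[]}) ∪ List.cons U '' {w | U :: w ∈ S}) ∪ List.cons D '' {w | D :: w ∈ S})
      ∪ List.cons H '' {w | H :: w ∈ S} := by
    ext w
    rcases w with _ | ⟨x, w⟩
    · simp
    · cases x <;> simp
  have f : ∀ x : Step, (List.cons x '' {w | x :: w ∈ S}).Finite := fun x =>
    hS.subset (by rintro _ ⟨w, hw, rfl⟩; exact hw)
  have f0 : (S ∩ {[]}).Finite := hS.subset Set.inter_subset_left
  conv_lhs => rw [e]
  rw [Set.ncard_union_eq _ ((f0.union (f U)).union (f D)) (f H),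
    Set.ncard_union_eq _ (f0.union (f U)) (f D), Set.ncard_union_eq _ f0 (f U),
    Set.ncard_image_of_injective _ (inj U), Set.ncard_image_of_injective _ (inj D),
    Set.ncard_image_of_injective _ (inj H)]
  · rw [Set.disjoint_left]; rintro w ⟨_, h⟩ ⟨v, _, rfl⟩; simp at h
  · rw [Set.disjoint_left]; rintro w (⟨_, h⟩ | ⟨v, _, rfl⟩) ⟨v', _, h'⟩
    · subst h'; simp at h
    · simp at h'
  · rw [Set.disjoint_left]; rintro w ((⟨_, h⟩ | ⟨v, _, rfl⟩) | ⟨v, _, rfl⟩) ⟨v', _, h'⟩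
    · subst h'; simp at h
    · simp at h'
    · simp at h'

theorem ncard_reverse (S : Set (List Step)) : {w : List Step | w.reverse ∈ S}.ncard = S.ncard := by
  rw [← Set.ncard_image_of_injective S List.reverse_injective]
  congr 1
  ext w
  constructor
  · intro h; exact ⟨_, h, by simp⟩
  · rintro ⟨v, h, rfl⟩; simpa using h

/-- Splitting a set of words by last letter. -/
theorem ncard_last (S : Set (List Step)) (hS : S.Finite) :
    S.ncard = (S ∩ {[]}).ncard + {w | w ++ [U] ∈ S}.ncard + {w | w ++ [D] ∈ S}.ncard
      + {w | w ++ [H] ∈ S}.ncard := by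
  have hf : {w : List Step | w.reverse ∈ S}.Finite :=
    hS.preimage List.reverse_injective.injOn
  have := ncard_first _ hf
  rw [ncard_reverse] at this
  rw [this]
  have e : ∀ x : Step, {w | x :: w ∈ {w : List Step | w.reverse ∈ S}}.ncard
      = {w | w ++ [x] ∈ S}.ncard := by
    intro x
    rw [← ncard_reverse {w | w ++ [x] ∈ S}]
    congr 1
    ext w; simp
  rw [e, e, e]
  congr 4
  ext w; simp
  rintro rfl; simp

theorem Pre_snoc (w : List Step) (x : Step) :
    Pre (w ++ [x]) ↔ Pre w ∧ countD (w ++ [x]) ≤ countU (w ++ [x]) := by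
  unfold Pre
  constructor
  · intro h
    exact ⟨fun p hp => h p (hp.trans (List.prefix_append _ _)), h _ List.prefix_rfl⟩
  · rintro ⟨h1, h2⟩ p hp
    rw [List.prefix_concat_iff] at hp
    rcases hp with rfl | hp
    · exact h2
    · exact h1 _ hp

/-- Prefix paths with `p` non-horizontal steps, `j` horizontal steps, ending at height `h`. -/
def ASet (p j h : ℕ) : Set (List Step) :=
  {w | Pre w ∧ countU w + countD w = p ∧ countH w = j ∧ countU w = countD w + h}

theorem ASet_fin (p j h : ℕ) : (ASet p j h).Finite :=
  finite_of_le _ (p + j) (by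
    rintro w ⟨_, h1, h2, _⟩; rw [length_counts]; omega)

theorem A_rec (p j h : ℕ) : (ASet p j h).ncard =
    (if p = 0 ∧ j = 0 ∧ h = 0 then 1 else 0)
    + (if p = 0 ∨ h = 0 then 0 else (ASet (p-1) j (h-1)).ncard)
    + (if p = 0 then 0 else (ASet (p-1) j (h+1)).ncard)
    + (if j = 0 then 0 else (ASet p (j-1) h).ncard) := by
  rw [ncard_last _ (ASet_fin p j h)]
  congr 1
  · congr 1
    · congr 1
      · split_ifs with hc
        · rw [Set.ncard_eq_one]
          refine ⟨[], ?_⟩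
          ext w; simp only [ASet, Set.mem_inter_iff, Set.mem_ofPred_eq, Set.mem_singleton_iff]
          constructor
          · exact fun h => h.2
          · rintro rfl
            obtain ⟨rfl, rfl, rfl⟩ := hc
            refine ⟨⟨?_, rfl, rfl, rfl⟩, rfl⟩
            intro p hp
            simp at hp; subst hp; simp [countD, countU]
        · rw [Set.ncard_eq_zero ((ASet_fin p j h).subset Set.inter_subset_left)]
          ext w
          simp only [ASet, Set.mem_inter_iff, Set.mem_ofPred_eq, Set.mem_singleton_iff,
            Set.mem_empty_iff_false, iff_false]
          rintro ⟨⟨_, h1, h2, h3⟩, rfl⟩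
          simp only [cU_nil, cD_nil, cH_nil] at *
          omega
      · split_ifs with hc
        · convert Set.ncard_empty (List Step)
          ext w
          simp only [ASet, Set.mem_ofPred_eq, Pre_snoc, cU_app, cD_app, cH_app, cU_cons, cD_cons,
            cH_cons, cU_nil, cD_nil, cH_nil, Set.mem_empty_iff_false, iff_false]
          rintro ⟨⟨h0, h4⟩, h1, h2, h3⟩
          have := h0 w List.prefix_rfl
          simp at *
          omega
        · congr 1
          ext w
          simp only [ASet, Set.mem_ofPred_eq, Pre_snoc, cU_app, cD_app, cH_app, cU_cons, cD_cons,
            cH_cons, cU_nil, cD_nil, cH_nil]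
          simp
          grind
    · split_ifs with hc
      · convert Set.ncard_empty (List Step)
        ext w
        simp only [ASet, Set.mem_ofPred_eq, Pre_snoc, cU_app, cD_app, cH_app, cU_cons, cD_cons,
            cH_cons, cU_nil, cD_nil, cH_nil, Set.mem_empty_iff_false, iff_false]
        simp
        omega
      · congr 1
        ext w
        simp only [ASet, Set.mem_ofPred_eq, Pre_snoc, cU_app, cD_app, cH_app, cU_cons, cD_cons,
            cH_cons, cU_nil, cD_nil, cH_nil]
        simp
        grind
  · split_ifs with hc
    · convert Set.ncard_empty (List Step)
      ext w
      simp only [ASet, Set.mem_ofPred_eq, Pre_snoc, cU_app, cD_app, cH_app, cU_cons, cD_cons,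
            cH_cons, cU_nil, cD_nil, cH_nil, Set.mem_empty_iff_false, iff_false]
      simp
      omega
    · congr 1
      ext w
      simp only [ASet, Set.mem_ofPred_eq, Pre_snoc, cU_app, cD_app, cH_app, cU_cons, cD_cons,
            cH_cons, cU_nil, cD_nil, cH_nil]
      simp
      grind

theorem A_formula (N : ℕ) : ∀ p j h : ℕ, p + j = N →
    (ASet p j h).ncard = (ASet p 0 h).ncard * Nat.choose (p + j) j := by
  induction N with
  | zero =>
    intro p j h hN
    obtain ⟨rfl, rfl⟩ : p = 0 ∧ j = 0 := by omega
    simp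
  | succ N ih =>
    intro p j h hN
    rcases j with _ | j
    · simp
    rcases p with _ | p
    · rw [A_rec, if_neg (by omega), if_pos (by simp), if_pos rfl, if_neg (by omega)]
      simp only [Nat.add_sub_cancel]
      rw [ih 0 j h (by omega)]
      simp
    · rw [A_rec (p+1) (j+1) h, A_rec (p+1) 0 h]
      simp only [Nat.add_sub_cancel, Nat.add_eq_zero_iff, one_ne_zero, and_false, false_and,
        false_or, if_false, if_true]
      have h1 := ih (p+1) j h (by omega)
      rw [A_rec (p+1) 0 h] at h1
      simp only [Nat.add_sub_cancel, Nat.add_eq_zero_iff, one_ne_zero, and_false, false_and,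
        false_or, if_false, if_true] at h1
      rw [h1, ih p (j+1) (h+1) (by omega), ih p (j+1) (h-1) (by omega)]
      have hc : (p + 1 + (j + 1)).choose (j+1) = (p + 1 + j).choose j + (p + (j+1)).choose (j+1) := by
        rw [show p + 1 + (j+1) = (p + 1 + j) + 1 by ring, Nat.choose_succ_succ,
          show p + 1 + j = p + (j+1) by ring]
      rw [hc]
      split_ifs <;> ring

theorem A_dyck (p h : ℕ) : dyckPrefixCount p h = (ASet p 0 h).ncard := by
  change Set.ncard {w | _} = _
  congr 1
  ext w
  have := length_counts w
  simp only [Set.mem_ofPred_eq, IsDyckPrefix, ASet, Pre]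
  grind

/-- Words with no `U`, `h` times `D` and `m` times `H`. -/
def BSet (m h : ℕ) : Set (List Step) := {w | countU w = 0 ∧ countD w = h ∧ countH w = m}

theorem BSet_fin (m h : ℕ) : (BSet m h).Finite :=
  finite_of_le _ (m + h) (by rintro w ⟨h1, h2, h3⟩; rw [length_counts]; omega)

theorem B_rec (m h : ℕ) : (BSet m h).ncard =
    (if m = 0 ∧ h = 0 then 1 else 0) + (if h = 0 then 0 else (BSet m (h-1)).ncard)
    + (if m = 0 then 0 else (BSet (m-1) h).ncard) := by
  rw [ncard_first _ (BSet_fin m h)]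
  have hU : {w | U :: w ∈ BSet m h}.ncard = 0 := by
    convert Set.ncard_empty (List Step)
    ext w; simp [BSet, cU_cons]
  rw [hU, add_zero]
  congr 1
  · congr 1
    · split_ifs with hc
      · rw [Set.ncard_eq_one]
        refine ⟨[], ?_⟩
        ext w
        simp only [BSet, Set.mem_inter_iff, Set.mem_ofPred_eq, Set.mem_singleton_iff]
        constructor
        · exact fun h => h.2
        · rintro rfl
          exact ⟨⟨rfl, hc.2.symm, hc.1.symm⟩, rfl⟩
      · rw [Set.ncard_eq_zero ((BSet_fin m h).subset Set.inter_subset_left)]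
        ext w
        simp only [BSet, Set.mem_inter_iff, Set.mem_ofPred_eq, Set.mem_singleton_iff,
            Set.mem_empty_iff_false, iff_false]
        rintro ⟨⟨h1, h2, h3⟩, rfl⟩
        simp only [cU_nil, cD_nil, cH_nil] at *
        omega
    · split_ifs with hc
      · convert Set.ncard_empty (List Step)
        ext w; simp [BSet, cD_cons]; omega
      · congr 1
        ext w; simp [BSet, cD_cons, cU_cons, cH_cons]; omega
  · split_ifs with hc
    · convert Set.ncard_empty (List Step)
      ext w; simp [BSet, cH_cons]; omega
    · congr 1
      ext w; simp [BSet, cD_cons, cU_cons, cH_cons]; omega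

theorem B_formula (N : ℕ) : ∀ m h : ℕ, m + h = N → (BSet m h).ncard = Nat.choose (m + h) h := by
  induction N with
  | zero =>
    intro m h hN
    obtain ⟨rfl, rfl⟩ : m = 0 ∧ h = 0 := by omega
    rw [B_rec]; simp
  | succ N ih =>
    intro m h hN
    rw [B_rec]
    rcases m with _ | m <;> rcases h with _ | h
    · omega
    · have := ih 0 h (by omega)
      simp [-Set.ncard_eq_one, this]
    · have := ih m 0 (by omega)
      simp [-Set.ncard_eq_one, this]
    · simp
      rw [ih m (h+1) (by omega), ih (m+1) h (by omega),
        show m + 1 + (h+1) = (m + 1 + h) + 1 by ring, Nat.choose_succ_succ,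
          show m + 1 + h = m + (h+1) by ring]

/-- A word with more than `j` letters `H` splits at its `(j+1)`-st `H`. -/
theorem split_exists (w : List Step) : ∀ j, j + 1 ≤ countH w →
    ∃ u v, w = u ++ H :: v ∧ countH u = j := by
  induction w with
  | nil => intro j h; simp [cH_nil] at h
  | cons x w ih =>
    intro j h
    by_cases hx : x = H
    · subst hx
      rcases j with _ | j
      · exact ⟨[], w, rfl, rfl⟩
      · obtain ⟨u, v, rfl, hu⟩ := ih j (by simpa [cH_cons] using h)
        exact ⟨H :: u, v, rfl, by simp [cH_cons, hu]⟩
    · obtain ⟨u, v, rfl, hu⟩ := ih j (by simpa [cH_cons, hx] using h)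
      exact ⟨x :: u, v, rfl, by simp [cH_cons, hu, hx]⟩

theorem split_unique (u : List Step) : ∀ u' v v' : List Step, countH u = countH u' →
    u ++ H :: v = u' ++ H :: v' → u = u' ∧ v = v' := by
  induction u with
  | nil =>
    intro u' v v' hc h
    rcases u' with _ | ⟨x, u'⟩
    · simpa using h
    · simp at h
      rw [← h.1] at hc
      simp [cH_cons, cH_nil] at hc
  | cons x u ih =>
    intro u' v v' hc h
    rcases u' with _ | ⟨y, u'⟩
    · simp at h
      rw [h.1] at hc
      simp [cH_cons, cH_nil] at hc
    · simp at h
      obtain ⟨rfl, h⟩ := h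
      obtain ⟨rfl, rfl⟩ := ih u' v v' (by simpa [cH_cons] using hc) h
      exact ⟨rfl, rfl⟩

theorem pattern_iff (u : List Step) : ∀ (j : ℕ) (v : List Step), countH u = j →
    ((List.replicate (j+1) H ++ [U, D]).Sublist (u ++ H :: v) ↔ [U, D].Sublist v) := by
  induction u with
  | nil =>
    rintro j v rfl
    simp [cH_nil]
  | cons x u ih =>
    intro j v hj
    by_cases hx : x = H
    · subst hx
      rcases j with _ | j
      · simp [cH_cons] at hj
      · rw [← ih j v (by simpa [cH_cons] using hj)]
        rw [List.replicate_succ, List.cons_append, List.cons_append, List.cons_sublist_cons]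
    · rw [← ih j v (by simpa [cH_cons, hx] using hj)]
      constructor
      · intro h
        rw [List.replicate_succ, List.cons_append] at h ⊢
        rw [List.cons_append] at h
        cases h with
        | cons _ h => exact h
        | cons_cons _ h => exact absurd rfl hx
      · intro h; exact h.cons _

theorem schroder_split (u v : List Step) :
    (IsSchroder (u ++ H :: v) ∧ ¬ [U, D].Sublist v) ↔
      (Pre u ∧ countU v = 0 ∧ countU u = countD u + countD v) := by
  constructor
  · rintro ⟨⟨h1, h2⟩, h3⟩
    have hv : countU v = 0 := by
      by_contra hne
      have hm : U ∈ v := List.count_pos_iff.mp (Nat.pos_of_ne_zero hne)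
      obtain ⟨a, b, rfl⟩ := List.append_of_mem hm
      have hb : countD b = 0 := by
        by_contra hb
        have hm' : D ∈ b := List.count_pos_iff.mp (Nat.pos_of_ne_zero hb)
        apply h3
        have : [U, D].Sublist (U :: b) := by simpa using hm'
        exact this.trans (List.sublist_append_right _ _)
      have := h1 (u ++ H :: a) ⟨U :: b, by simp⟩
      simp [cU_app, cD_app, cU_cons, cD_cons] at *
      omega
    refine ⟨fun p hp => h1 p (hp.trans (List.prefix_append _ _)), hv, ?_⟩
    simp [cU_app, cD_app, cU_cons, cD_cons] at h2
    omega
  · rintro ⟨h1, h2, h3⟩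
    refine ⟨⟨?_, ?_⟩, ?_⟩
    · intro p hp
      rcases List.prefix_or_prefix_of_prefix hp (List.prefix_append u (H :: v)) with hq | ⟨q, rfl⟩
      · exact h1 p hq
      · rw [List.prefix_append_right_inj] at hp
        have hs : countD q ≤ countD (H :: v) := hp.sublist.count_le _
        simp [cU_app, cD_app, cD_cons] at *
        omega
    · simp [cU_app, cD_app, cU_cons, cD_cons]; omega
    · intro h
      have : U ∈ v := h.subset (by simp)
      have := List.count_pos_iff.mpr this
      unfold countU at h2
      omega

theorem multichoose_succ (m i : ℕ) : multichoose (m + 1) i = Nat.choose (m + i) i := by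
  unfold multichoose
  congr 1
  omega

/-- Avoiding words with at least `j + 1` letters `H`. -/
def S2 (n j : ℕ) : Set (List Step) :=
  {w | IsSchroder w ∧ semilength w = n ∧ ¬ (List.replicate (j+1) H ++ [U, D]).Sublist w ∧
    j + 1 ≤ countH w}

theorem schroder_fin (n : ℕ) (S : Set (List Step))
    (h : ∀ w ∈ S, IsSchroder w ∧ semilength w = n) : S.Finite :=
  finite_of_le _ (2 * n) (by
    intro w hw
    obtain ⟨⟨_, h1⟩, h2⟩ := h w hw
    unfold semilength at h2
    rw [length_counts]; omega)

theorem S2_card (n j : ℕ) : (S2 n j).ncard =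
    ∑ p ∈ Finset.Icc (0 : ℤ) (2 * (n : ℤ) - 2 * j - 2),
      ∑ h ∈ Finset.Icc (0 : ℤ) (2 * (n : ℤ) - p - 2 * j - 2),
        (ASet p.toNat j h.toNat).ncard *
          (BSet ((2 * (n : ℤ) - h - p - 2 * j - 2) / 2).toNat h.toNat).ncard := by
  have hfin : (S2 n j).Finite := schroder_fin n _ (fun w hw => ⟨hw.1, hw.2.1⟩)
  rw [Set.ncard_eq_toFinset_card _ hfin]
  simp only [Set.ncard_eq_toFinset_card _ (ASet_fin _ _ _),
    Set.ncard_eq_toFinset_card _ (BSet_fin _ _), ← Finset.card_product]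
  rw [Finset.sum_sigma', ← Finset.card_sigma]
  symm
  refine Finset.card_bij (fun x _ => x.2.1 ++ H :: x.2.2) ?_ ?_ ?_
  · rintro ⟨⟨p, h⟩, u, v⟩ hx
    simp only [Finset.mem_sigma, Finset.mem_Icc, Finset.mem_product, Set.Finite.mem_toFinset] at hx ⊢
    obtain ⟨⟨⟨hp0, hp1⟩, hh0, hh1⟩, ⟨hu1, hu2, hu3, hu4⟩, hv1, hv2, hv3⟩ := hx
    have hs := (schroder_split u v).mpr ⟨hu1, hv1, by omega⟩
    refine ⟨hs.1, ?_, ?_, ?_⟩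
    · simp [semilength, cU_app, cH_app, cU_cons, cH_cons]
      omega
    · rw [pattern_iff u j v hu3]; exact hs.2
    · simp [cH_app, cH_cons]; omega
  · rintro ⟨⟨p, h⟩, u, v⟩ hx ⟨⟨p', h'⟩, u', v'⟩ hx' he
    simp only [Finset.mem_sigma, Finset.mem_Icc, Finset.mem_product, Set.Finite.mem_toFinset]
      at hx hx' he
    obtain ⟨⟨⟨hp0, hp1⟩, hh0, hh1⟩, ⟨hu1, hu2, hu3, hu4⟩, hv1, hv2, hv3⟩ := hx
    obtain ⟨⟨⟨hp0', hp1'⟩, hh0', hh1'⟩, ⟨hu1', hu2', hu3', hu4'⟩, hv1', hv2', hv3'⟩ := hx'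
    obtain ⟨rfl, rfl⟩ := split_unique u u' v v' (by omega) he
    obtain rfl : p = p' := by omega
    obtain rfl : h = h' := by omega
    rfl
  · intro w hw
    simp only [Set.Finite.mem_toFinset] at hw
    obtain ⟨h1, h2, h3, h4⟩ := hw
    obtain ⟨u, v, rfl, hu⟩ := split_exists w j h4
    rw [pattern_iff u j v hu] at h3
    obtain ⟨g1, g2, g3⟩ := (schroder_split u v).mp ⟨h1, h3⟩
    simp [semilength, cU_app, cH_app, cU_cons, cH_cons] at h2
    refine ⟨⟨⟨((countU u + countD u : ℕ) : ℤ), (countD v : ℤ)⟩, u, v⟩, ?_, rfl⟩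
    simp only [Finset.mem_sigma, Finset.mem_Icc, Finset.mem_product, Set.Finite.mem_toFinset]
    refine ⟨⟨⟨by omega, by omega⟩, by omega, by omega⟩, ⟨g1, by omega, hu, by omega⟩,
      g2, by omega, by omega⟩

theorem avoid_split (n j : ℕ) :
    schroderAvoidCount n (List.replicate (j+1) H ++ [U, D]) =
      ∑ q ∈ Finset.range (j+1), schroderHCount n q + (S2 n j).ncard := by
  have hfin : ∀ q, {w : List Step | IsSchroder w ∧ semilength w = n ∧ countH w = q}.Finite :=
    fun q => schroder_fin n _ (fun w hw => ⟨hw.1, hw.2.1⟩)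
  have hfin2 : (S2 n j).Finite := schroder_fin n _ (fun w hw => ⟨hw.1, hw.2.1⟩)
  have hfin1 : {w : List Step | IsSchroder w ∧ semilength w = n ∧ countH w < j + 1}.Finite :=
    schroder_fin n _ (fun w hw => ⟨hw.1, hw.2.1⟩)
  have e1 : ∑ q ∈ Finset.range (j+1), schroderHCount n q =
      {w : List Step | IsSchroder w ∧ semilength w = n ∧ countH w < j + 1}.ncard := by
    rw [Set.ncard_eq_toFinset_card _ hfin1,
      Finset.card_eq_sum_card_fiberwise (f := countH) (t := Finset.range (j+1))]
    · refine Finset.sum_congr rfl fun q hq => ?_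
      refine Nat.subtype_card _ fun w => ?_
      simp only [Finset.mem_filter, Set.Finite.mem_toFinset, Set.mem_ofPred_eq]
      rw [Finset.mem_range] at hq
      grind
    · intro w hw
      simp at hw ⊢
      exact hw.2.2
  rw [e1, ← Set.ncard_union_eq _ hfin1 hfin2]
  · change Set.ncard {w | _} = _
    congr 1
    ext w
    simp only [Set.mem_ofPred_eq, S2, Set.mem_union]
    constructor
    · rintro ⟨h1, h2, h3⟩
      rcases Nat.lt_or_ge (countH w) (j+1) with h | h
      · exact Or.inl ⟨h1, h2, h⟩
      · exact Or.inr ⟨h1, h2, h3, h⟩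
    · rintro (⟨h1, h2, h3⟩ | ⟨h1, h2, h3, h4⟩)
      · refine ⟨h1, h2, fun hs => ?_⟩
        have := hs.count_le H
        simp [List.count_append, List.count_replicate] at this
        unfold countH at h3
        omega
      · exact ⟨h1, h2, h3⟩
  · rw [Set.disjoint_left]
    rintro w ⟨_, _, h⟩ ⟨_, _, _, h'⟩
    omega

theorem schroder_avoid_HkUD (n k : ℕ) (hk : 2 ≤ k) :
    (schroderAvoidCount n (List.replicate (k - 1) Step.H ++ [Step.U, Step.D]) : ℤ) =
      (∑ q ∈ Finset.range (k - 1), (schroderHCount n q : ℤ))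
      + ∑ p ∈ Finset.Icc (0 : ℤ) (2 * (n : ℤ) - 2 * (k : ℤ) + 2),
          ∑ h ∈ Finset.Icc (0 : ℤ) (2 * (n : ℤ) - p - 2 * (k : ℤ) + 2),
            (dyckPrefixCount p.toNat h.toNat : ℤ) *
              (multichoose (p.toNat + 1) (k - 2) : ℤ) *
              (multichoose ((2 * (n : ℤ) - h - p - 2 * (k : ℤ) + 4) / 2).toNat h.toNat : ℤ) := by
  obtain ⟨j, rfl⟩ : ∃ j, k = j + 2 := ⟨k - 2, by omega⟩
  rw [show j + 2 - 1 = j + 1 by omega, show j + 2 - 2 = j by omega, avoid_split, S2_card]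
  push_cast
  congr 1
  rw [show 2 * (n : ℤ) - 2 * ((j : ℤ) + 2) + 2 = 2 * n - 2 * j - 2 by ring]
  refine Finset.sum_congr rfl fun p hp => ?_
  rw [show 2 * (n : ℤ) - p - 2 * ((j : ℤ) + 2) + 2 = 2 * n - p - 2 * j - 2 by ring]
  refine Finset.sum_congr rfl fun h hh => ?_
  rw [Finset.mem_Icc] at hp hh
  rw [A_formula _ p.toNat j h.toNat rfl, B_formula _ _ _ rfl, A_dyck, multichoose_succ,
    show ((2 * (n : ℤ) - h - p - 2 * ((j : ℤ) + 2) + 4) / 2).toNat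
      = ((2 * (n : ℤ) - h - p - 2 * j - 2) / 2).toNat + 1 by omega, multichoose_succ]
  push_cast
  ring
end

section
/- For every n ≥ 0, the number of Schröder words of semilength n avoiding the pattern HUD equals C_n + Σ_{p=0}^{2n−2} Σ_{h=0}^{2n−p−2} P_{p,h} · multichoose((2n−h−p)/2, h), where C_n is the n-th Catalan number, P_{p,h} is the number of Dyck prefixes of length p ending at height h, multichoose(m, i) = binom(m+i−1, i), and terms with p ≢ h (mod 2) vanish since then P_{p,h} = 0. -/
namespace SchroderHUD

theorem length_eq (w : List Step) : w.length = countU w + countD w + countH w := by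
  induction w with
  | nil => rfl
  | cons s w ih =>
    cases s <;> simp [countU, countD, countH] at * <;> omega

theorem finite_step : Finite Step :=
  Finite.of_surjective (fun i : Fin 3 => if i = 0 then Step.U else if i = 1 then Step.D else Step.H)
    (by
      intro s
      cases s
      · exact ⟨0, by decide⟩
      · exact ⟨1, by decide⟩
      · exact ⟨2, by decide⟩)

theorem finite_sub (P : List Step → Prop) (N : ℕ) (h : ∀ w, P w → w.length ≤ N) :
    Finite {w : List Step // P w} := by
  haveI := finite_step
  exact ((List.finite_length_le Step N).subset (fun w hw => h w hw) : Set.Finite {w | P w})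

/-- words with `h` letters `D`, `k` letters `H` and no `U`. -/
def Tail (h k : ℕ) : Set (List Step) := {v | countU v = 0 ∧ countD v = h ∧ countH v = k}

theorem tail_finite (h k : ℕ) : (Tail h k).Finite :=
  finite_sub _ (h + k) (by
    rintro w ⟨h1, h2, h3⟩
    rw [length_eq]
    omega)

theorem tail_zero_left (k : ℕ) : Tail 0 k = {List.replicate k Step.H} := by
  ext v
  simp only [Tail, Set.mem_setOf_eq, Set.mem_singleton_iff]
  constructor
  · rintro ⟨h1, h2, h3⟩
    rw [List.eq_replicate_iff]
    refine ⟨by rw [length_eq]; omega, ?_⟩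
    intro b hb
    cases b
    · exact absurd hb (List.count_eq_zero.1 h1)
    · exact absurd hb (List.count_eq_zero.1 h2)
    · rfl
  · rintro rfl
    simp [countU, countD, countH, List.count_replicate]

theorem tail_zero_right (k : ℕ) : Tail k 0 = {List.replicate k Step.D} := by
  ext v
  simp only [Tail, Set.mem_setOf_eq, Set.mem_singleton_iff]
  constructor
  · rintro ⟨h1, h2, h3⟩
    rw [List.eq_replicate_iff]
    refine ⟨by rw [length_eq]; omega, ?_⟩
    intro b hb
    cases b
    · exact absurd hb (List.count_eq_zero.1 h1)
    · rfl
    · exact absurd hb (List.count_eq_zero.1 h3)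
  · rintro rfl
    simp [countU, countD, countH, List.count_replicate]

theorem tail_succ (h k : ℕ) : Tail (h + 1) (k + 1) =
    (List.cons Step.D '' Tail h (k + 1)) ∪ (List.cons Step.H '' Tail (h + 1) k) := by
  ext v
  rcases v with _ | ⟨s, v⟩
  · simp [Tail, countD]
  · cases s <;> simp [Tail, countD, countU, countH]

theorem tail_card : ∀ h k : ℕ, (Tail h k).ncard = (h + k).choose h
  | 0, k => by simp [tail_zero_left]
  | h + 1, 0 => by simp [tail_zero_right]
  | h + 1, k + 1 => by
    have hd : Disjoint (List.cons Step.D '' Tail h (k + 1)) (List.cons Step.H '' Tail (h + 1) k) := by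
      rw [Set.disjoint_left]
      rintro _ ⟨a, _, rfl⟩ ⟨b, _, hb⟩
      simp at hb
    rw [tail_succ, Set.ncard_union_eq hd ((tail_finite _ _).image _) ((tail_finite _ _).image _),
      Set.ncard_image_of_injective _ (List.cons_injective),
      Set.ncard_image_of_injective _ (List.cons_injective), tail_card h (k + 1), tail_card (h + 1) k]
    have e1 : h + 1 + (k + 1) = (h + (k + 1)) + 1 := by omega
    have e2 : h + 1 + k = h + (k + 1) := by omega
    rw [e1, e2, Nat.choose_succ_succ]

theorem prefix_split {α : Type*} {p a b : List α} (h : p <+: a ++ b) :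
    p <+: a ∨ ∃ q, q <+: b ∧ p = a ++ q := by
  rcases List.prefix_or_prefix_of_prefix h (List.prefix_append a b) with h1 | ⟨q, rfl⟩
  · exact Or.inl h1
  · exact Or.inr ⟨q, (List.prefix_append_right_inj a).1 h, rfl⟩

theorem split_inj {α : Type*} {x : α} : ∀ {a a' b b' : List α}, x ∉ a → x ∉ a' →
    a ++ x :: b = a' ++ x :: b' → a = a' ∧ b = b'
  | [], [], _, _, _, _, h => by simpa using h
  | [], y :: a', _, _, _, h2, h => by simp_all
  | y :: a, [], _, _, h1, _, h => by simp_all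
  | y :: a, z :: a', b, b', h1, h2, h => by
    simp only [List.cons_append, List.cons.injEq] at h
    simp only [List.mem_cons, not_or] at h1 h2
    obtain ⟨e1, e2⟩ := split_inj h1.2 h2.2 h.2
    exact ⟨by rw [h.1, e1], e2⟩

theorem join_good {n p h : ℕ} {a b : List Step} (hph : p + h + 2 ≤ 2 * n)
    (ha : IsDyckPrefix a ∧ a.length = p ∧ countU a = countD a + h)
    (hb : b ∈ Tail h (n - 1 - (p + h) / 2)) :
    (IsSchroder (a ++ Step.H :: b) ∧ semilength (a ++ Step.H :: b) = n ∧
      ¬ [Step.H, Step.U, Step.D].Sublist (a ++ Step.H :: b)) ∧ Step.H ∈ a ++ Step.H :: b := by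
  obtain ⟨⟨ha0, ha1⟩, ha2, ha3⟩ := ha
  obtain ⟨hb1, hb2, hb3⟩ := hb
  have hl := length_eq a
  refine ⟨⟨⟨?_, ?_⟩, ?_, ?_⟩, by simp⟩
  · intro q hq
    rcases prefix_split hq with hq | ⟨r, hr, rfl⟩
    · exact ha1 q hq
    · have := hr.sublist.count_le Step.D
      simp [countU, countD] at *
      omega
  · simp [countU, countD, countH] at *
    omega
  · simp [semilength, countU, countD, countH] at *
    omega
  · intro hs
    rw [List.sublist_append_iff] at hs
    obtain ⟨l1, l2, e, s1, s2⟩ := hs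
    rcases l1 with _ | ⟨x, l1⟩
    · simp only [List.nil_append] at e
      subst e
      have : [Step.U, Step.D].Sublist b := by simpa using s2
      exact List.count_eq_zero.1 hb1 (this.subset (by simp))
    · simp only [List.cons_append, List.cons.injEq] at e
      exact List.count_eq_zero.1 ha0 (s1.subset (by simp [← e.1]))

theorem split_good {n : ℕ} {a b : List Step} (hH : Step.H ∉ a)
    (hw : IsSchroder (a ++ Step.H :: b) ∧ semilength (a ++ Step.H :: b) = n ∧
      ¬ [Step.H, Step.U, Step.D].Sublist (a ++ Step.H :: b)) :
    ∃ p h, p + h + 2 ≤ 2 * n ∧ (IsDyckPrefix a ∧ a.length = p ∧ countU a = countD a + h) ∧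
      b ∈ Tail h (n - 1 - (p + h) / 2) := by
  obtain ⟨⟨hp, he⟩, hn, hs⟩ := hw
  have hl := length_eq a
  have ha0 : countH a = 0 := List.count_eq_zero.2 hH
  have hU : countU b = 0 := by
    apply List.count_eq_zero.2
    intro hu
    obtain ⟨c, d, rfl⟩ := List.append_of_mem hu
    have hd : countD d = 0 := by
      apply List.count_eq_zero.2
      intro hd
      apply hs
      refine List.Sublist.trans ?_ (List.sublist_append_right _ _)
      refine List.Sublist.cons_cons _ ?_
      refine List.Sublist.trans ?_ (List.sublist_append_right _ _)
      exact List.Sublist.cons_cons _ (List.singleton_sublist.2 hd)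
    have := hp (a ++ Step.H :: c) (by simp)
    simp [countU, countD, countH] at *
    omega
  have hpa := hp a (by simp)
  refine ⟨a.length, countU a - countD a, ?_, ⟨⟨ha0, ?_⟩, rfl, by omega⟩, hU, ?_, ?_⟩
  · simp [semilength, countU, countD, countH] at *
    omega
  · intro q hq
    exact hp q (hq.trans (List.prefix_append _ _))
  · simp [semilength, countU, countD, countH] at *
    omega
  · simp [semilength, countU, countD, countH] at *
    omega

/-- forget to `Step`. -/
def toStep : DyckStep → Step
  | .U => .U
  | .D => .D

/-- forget to `DyckStep`. -/
def ofStep : Step → DyckStep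
  | .U => .U
  | _ => .D

theorem cU (l : List DyckStep) : countU (l.map toStep) = l.count .U := by
  induction l with
  | nil => rfl
  | cons s l ih => cases s <;> simp [countU, toStep] at * <;> exact ih

theorem cD (l : List DyckStep) : countD (l.map toStep) = l.count .D := by
  induction l with
  | nil => rfl
  | cons s l ih => cases s <;> simp [countD, toStep] at * <;> exact ih

theorem cH (l : List DyckStep) : Step.H ∉ l.map toStep := by
  induction l with
  | nil => simp
  | cons s l ih => cases s <;> simp [toStep] at * <;> exact ih

theorem map_of (w : List Step) (h : Step.H ∉ w) : (w.map ofStep).map toStep = w := by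
  induction w with
  | nil => rfl
  | cons s l ih => cases s <;> simp [toStep, ofStep] at * <;> exact ih h

theorem toStep_inj : Function.Injective toStep := by
  intro a b h
  cases a <;> cases b <;> simp [toStep] at * 

theorem dyck_good (d : DyckWord) : (IsSchroder (d.toList.map toStep) ∧
    semilength (d.toList.map toStep) = d.semilength ∧
    ¬ [Step.H, Step.U, Step.D].Sublist (d.toList.map toStep)) ∧
    Step.H ∉ d.toList.map toStep := by
  refine ⟨⟨⟨?_, ?_⟩, ?_, fun hs => cH _ (hs.subset (by simp))⟩, cH _⟩
  · intro q hq
    rw [List.prefix_iff_eq_take] at hq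
    rw [hq, ← List.map_take, cU, cD]
    exact d.count_D_le_count_U _
  · rw [cU, cD]; exact d.count_U_eq_count_D
  · have : countH (d.toList.map toStep) = 0 := List.count_eq_zero.2 (cH _)
    rw [semilength, this, cU]; rfl

theorem noH_card (n : ℕ) : Nat.card {w : List Step // (IsSchroder w ∧ semilength w = n ∧
    ¬ [Step.H, Step.U, Step.D].Sublist w) ∧ Step.H ∉ w} = catalan n := by
  rw [← DyckWord.card_dyckWord_semilength_eq_catalan, ← Nat.card_eq_fintype_card]
  symm
  refine Nat.card_congr (Equiv.ofBijective (fun d => ⟨d.1.toList.map toStep, ?_⟩) ⟨?_, ?_⟩)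
  · have := dyck_good d.1
    rw [d.2] at this
    exact this
  · rintro ⟨d, hd⟩ ⟨e, he⟩ h
    simp only [Subtype.mk.injEq] at h ⊢
    exact DyckWord.ext (List.map_injective_iff.2 toStep_inj h)
  · rintro ⟨w, ⟨⟨hp, he⟩, hn, hs⟩, hH⟩
    have hw := map_of w hH
    refine ⟨⟨⟨w.map ofStep, ?_, ?_⟩, ?_⟩, ?_⟩
    · rw [← cU, ← cD, hw]; exact he
    · intro i
      rw [← cU, ← cD, List.map_take, hw]
      exact hp _ (List.take_prefix _ _)
    · have h0 : countH w = 0 := List.count_eq_zero.2 hH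
      change (w.map ofStep).count .U = n
      rw [← cU, hw, ← hn, semilength, h0]; rfl
    · exact Subtype.ext hw

/-- index set. -/
def Idx (n : ℕ) : Finset (ℕ × ℕ) :=
  ((Finset.range (2 * n)) ×ˢ (Finset.range (2 * n))).filter (fun x => x.1 + x.2 + 2 ≤ 2 * n)

theorem mem_Idx {n : ℕ} {x : ℕ × ℕ} : x ∈ Idx n ↔ x.1 + x.2 + 2 ≤ 2 * n := by
  simp [Idx]; omega

theorem withH_card (n : ℕ) : Nat.card {w : List Step // (IsSchroder w ∧ semilength w = n ∧
    ¬ [Step.H, Step.U, Step.D].Sublist w) ∧ Step.H ∈ w} =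
    ∑ x ∈ Idx n, dyckPrefixCount x.1 x.2 *
      (x.2 + (n - 1 - (x.1 + x.2) / 2)).choose x.2 := by
  have hfin : ∀ x : Idx n, Finite ({w : List Step // IsDyckPrefix w ∧ w.length = x.1.1 ∧
      countU w = countD w + x.1.2} × Tail x.1.2 (n - 1 - (x.1.1 + x.1.2) / 2)) := by
    intro x
    haveI := (tail_finite x.1.2 (n - 1 - (x.1.1 + x.1.2) / 2)).to_subtype
    haveI := finite_sub (fun w => IsDyckPrefix w ∧ w.length = x.1.1 ∧
      countU w = countD w + x.1.2) x.1.1 (fun w hw => hw.2.1.le)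
    infer_instance
  have key : Nat.card (Σ x : Idx n, ({w : List Step // IsDyckPrefix w ∧ w.length = x.1.1 ∧
      countU w = countD w + x.1.2} × Tail x.1.2 (n - 1 - (x.1.1 + x.1.2) / 2))) =
      ∑ x ∈ Idx n, dyckPrefixCount x.1 x.2 *
      (x.2 + (n - 1 - (x.1 + x.2) / 2)).choose x.2 := by
    rw [Nat.card_sigma, ← Finset.sum_coe_sort (Idx n)]
    refine Finset.sum_congr rfl (fun x _ => ?_)
    rw [Nat.card_prod, Nat.card_coe_set_eq, tail_card]
    rfl
  rw [← key]
  symm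
  refine Nat.card_congr (Equiv.ofBijective (fun s => ⟨s.2.1.1 ++ Step.H :: s.2.2.1,
    join_good (mem_Idx.1 s.1.2) s.2.1.2 s.2.2.2⟩) ⟨?_, ?_⟩)
  · rintro ⟨⟨⟨p, h⟩, hx⟩, ⟨a, ha⟩, ⟨b, hb⟩⟩ ⟨⟨⟨p', h'⟩, hx'⟩, ⟨a', ha'⟩, ⟨b', hb'⟩⟩ e
    simp only [Subtype.mk.injEq] at e
    obtain ⟨rfl, rfl⟩ := split_inj (List.count_eq_zero.1 ha.1.1) (List.count_eq_zero.1 ha'.1.1) e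
    obtain rfl : p = p' := ha.2.1.symm.trans ha'.2.1
    obtain rfl : h = h' := by
      have h1 := ha.2.2
      have h2 := ha'.2.2
      simp only at h1 h2
      omega
    rfl
  · rintro ⟨w, hw, hH⟩
    obtain ⟨a, b, rfl, hna⟩ := List.eq_append_cons_of_mem hH
    obtain ⟨p, h, hph, ha, hb⟩ := split_good hna hw
    exact ⟨⟨⟨(p, h), mem_Idx.2 hph⟩, ⟨a, ha⟩, ⟨b, hb⟩⟩, rfl⟩

theorem total (n : ℕ) : schroderAvoidCount n [Step.H, Step.U, Step.D] =
    catalan n + ∑ x ∈ Idx n, dyckPrefixCount x.1 x.2 *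
      (x.2 + (n - 1 - (x.1 + x.2) / 2)).choose x.2 := by
  rw [← noH_card, ← withH_card, schroderAvoidCount]
  have hfin : Set.Finite {w : List Step | IsSchroder w ∧ semilength w = n ∧
      ¬ [Step.H, Step.U, Step.D].Sublist w} := by
    refine finite_sub _ (2 * n) ?_
    rintro w ⟨⟨_, he⟩, hn, _⟩
    rw [length_eq]
    rw [semilength] at hn
    omega
  have h := Set.ncard_inter_add_ncard_diff_eq_ncard {w : List Step | IsSchroder w ∧
    semilength w = n ∧ ¬ [Step.H, Step.U, Step.D].Sublist w} {w | Step.H ∈ w} hfin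
  rw [add_comm]
  exact h.symm

theorem prefix_odd (p h : ℕ) (hodd : (p + h) % 2 = 1) : dyckPrefixCount p h = 0 := by
  rw [dyckPrefixCount, Nat.card_eq_zero]
  left
  constructor
  rintro ⟨w, ⟨h0, _⟩, h1, h2⟩
  have := length_eq w
  omega

theorem sum_eq (n : ℕ) : ((∑ x ∈ Idx n, dyckPrefixCount x.1 x.2 *
      (x.2 + (n - 1 - (x.1 + x.2) / 2)).choose x.2 : ℕ) : ℤ) =
    ∑ p ∈ Finset.Icc (0 : ℤ) (2 * (n : ℤ) - 2),
          ∑ h ∈ Finset.Icc (0 : ℤ) (2 * (n : ℤ) - p - 2),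
            (dyckPrefixCount p.toNat h.toNat : ℤ) *
              (multichoose ((2 * (n : ℤ) - h - p) / 2).toNat h.toNat : ℤ) := by
  rw [Finset.sum_sigma', Nat.cast_sum]
  refine Finset.sum_bij' (fun x _ => ⟨(x.1 : ℤ), (x.2 : ℤ)⟩)
    (fun s _ => (s.1.toNat, s.2.toNat)) ?_ ?_ ?_ ?_ ?_
  · rintro ⟨p, h⟩ hx
    rw [mem_Idx] at hx
    simp only [Finset.mem_sigma, Finset.mem_Icc] at *
    omega
  · rintro ⟨p, h⟩ hx
    rw [mem_Idx]
    simp only [Finset.mem_sigma, Finset.mem_Icc] at *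
    omega
  · rintro ⟨p, h⟩ hx
    simp
  · rintro ⟨p, h⟩ hx
    simp only [Finset.mem_sigma, Finset.mem_Icc] at hx
    simp only [Int.toNat_of_nonneg hx.1.1, Int.toNat_of_nonneg hx.2.1]
  · rintro ⟨p, h⟩ hx
    rw [mem_Idx] at hx
    simp only [Int.toNat_natCast] at *
    rcases Nat.mod_two_eq_zero_or_one (p + h) with hm | hm
    · have e : h + (n - 1 - (p + h) / 2) =
        ((2 * (n : ℤ) - (h : ℤ) - (p : ℤ)) / 2).toNat + h - 1 := by omega
      rw [multichoose, ← e, Nat.cast_mul]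
    · simp [prefix_odd p h hm]

end SchroderHUD


theorem schroder_avoid_HUD (n : ℕ) :
    (schroderAvoidCount n [Step.H, Step.U, Step.D] : ℤ) =
      (catalan n : ℤ)
      + ∑ p ∈ Finset.Icc (0 : ℤ) (2 * (n : ℤ) - 2),
          ∑ h ∈ Finset.Icc (0 : ℤ) (2 * (n : ℤ) - p - 2),
            (dyckPrefixCount p.toNat h.toNat : ℤ) *
              (multichoose ((2 * (n : ℤ) - h - p) / 2).toNat h.toNat : ℤ) := by
  rw [SchroderHUD.total, Nat.cast_add, SchroderHUD.sum_eq]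
end
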